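/- Let G be a connected finite simple (C₄,C₅)-free graph of order n and minimum degree δ ≥ 3. Then avec(G) ≤ (9/2)·⌈n/δ°⌉ + 8, where δ° = 2δ² − 5δ + 5 if δ is even and δ° = 2δ² − 5δ + 7 if δ is odd. -/

import Mathlib

open SimpleGraph

/-- The eccentricity of a vertex `v`: the maximum distance from `v` to a vertex of `G`. -/
noncomputable def eccent {V : Type*} (G : SimpleGraph V) (v : V) : ℕ :=
  sSup (Set.range (G.dist v))

/-- The average eccentricity of a finite graph `G`. -/
noncomputable def avec {V : Type*} (G : SimpleGraph V) : ℝ :=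
  (∑ᶠ v, (eccent G v : ℝ)) / (Nat.card V)

/-- `G` contains no cycle of length `m` as a (not necessarily induced) subgraph. -/
def CycleFree {V : Type*} (G : SimpleGraph V) (m : ℕ) : Prop :=
  ∀ ⦃v : V⦄ (w : G.Walk v v), w.IsCycle → w.length ≠ m

/-! ### Eccentricities in trees -/

lemma dist_le_eccent {V : Type*} [Finite V] (G : SimpleGraph V) (u v : V) :
    G.dist u v ≤ _root_.eccent G u :=
  le_csSup (Set.finite_range _).bddAbove ⟨v, rfl⟩

lemma eccent_le {V : Type*} (G : SimpleGraph V) {v : V} {r : ℕ} (h : ∀ w, G.dist v w ≤ r) :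
    _root_.eccent G v ≤ r :=
  haveI : Nonempty V := ⟨v⟩
  csSup_le (Set.range_nonempty _) (by rintro _ ⟨w, rfl⟩; exact h w)

lemma SimpleGraph.Walk.dist_add_dist_of_mem_support {V : Type*} {G : SimpleGraph V} {u v x : V}
    (p : G.Walk u v) (hx : x ∈ p.support) : G.dist u x + G.dist x v ≤ p.length := by
  classical
  calc G.dist u x + G.dist x v ≤ (p.takeUntil x hx).length + (p.dropUntil x hx).length :=
        Nat.add_le_add (dist_le _) (dist_le _)
    _ = p.length := by rw [← Walk.length_append, Walk.take_spec]

/-- In a tree, a vertex on a longest geodesic has one of the ends of that geodesic among its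
farthest vertices. -/
lemma SimpleGraph.IsTree.eccent_le_of_mem_support {V : Type*} {T : SimpleGraph V} (hT : T.IsTree)
    {a b x : V} (hmax : ∀ y z, T.dist y z ≤ T.dist a b) (p : T.Walk a b) (hp : p.IsPath)
    (hx : x ∈ p.support) :
    _root_.eccent T x ≤ max (T.dist a b - T.dist x a) (T.dist a b - T.dist x b) := by
  classical
  refine eccent_le T fun y => ?_
  obtain ⟨q, hq⟩ := hT.connected.exists_walk_length_eq_dist y a
  obtain ⟨r, hr⟩ := hT.connected.exists_walk_length_eq_dist y b
  have hpath : (q.reverse.append r).bypass = p :=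
    (hT.existsUnique_path a b).unique (Walk.bypass_isPath _) hp
  have hmem : x ∈ (q.reverse.append r).support :=
    Walk.support_bypass_subset_support _ (hpath ▸ hx)
  rw [Walk.mem_support_append_iff, Walk.support_reverse, List.mem_reverse] at hmem
  have hya := hmax y a
  have hyb := hmax y b
  rw [dist_comm (u := x) (v := y)]
  rcases hmem with h | h
  · have := q.dist_add_dist_of_mem_support h
    omega
  · have := r.dist_add_dist_of_mem_support h
    omega

lemma sq_le_four_mul_sum_min (d : ℕ) :
    d ^ 2 ≤ 4 * ∑ j ∈ Finset.range (d + 1), min j (d - j) + 1 := by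
  induction d using Nat.twoStepInduction with
  | zero => simp
  | one => simp [Finset.sum_range_succ]
  | more d ih _ =>
    have h : ∑ j ∈ Finset.range (d + 2 + 1), min j (d + 2 - j) =
        ∑ j ∈ Finset.range (d + 1), min j (d - j) + (d + 1) := by
      rw [Finset.sum_range_succ, Finset.sum_range_succ']
      have : ∀ j ∈ Finset.range (d + 1), min (j + 1) (d + 2 - (j + 1)) = min j (d - j) + 1 := by
        intro j hj
        have := Finset.mem_range.1 hj
        omega
      rw [Finset.sum_congr rfl this, Finset.sum_add_distrib]
      simp
    rw [h]
    nlinarith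

/-- If the vertices of a tree carry weights at least `D`, given by the fibres of a map `f`, then
the weighted average eccentricity is at most that of a path of order `K ≥ |V| / D`. -/
lemma SimpleGraph.IsTree.four_mul_sum_eccent_le {I V : Type*} [Fintype I] [Fintype V]
    [DecidableEq I] {T : SimpleGraph I} (hT : T.IsTree) (f : V → I) {D K : ℕ}
    (hf : ∀ i, D ≤ (Finset.univ.filter fun v => f v = i).card) (hD : 0 < D)
    (hK : Fintype.card V ≤ K * D) :
    4 * ((∑ v, _root_.eccent T (f v) : ℕ) : ℤ) ≤ Fintype.card V * (3 * K - 2) := by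
  classical
  have hne := hT.connected.nonempty
  obtain ⟨⟨a, b⟩, hab⟩ := Finite.exists_max fun p : I × I => T.dist p.1 p.2
  replace hab : ∀ y z, T.dist y z ≤ T.dist a b := fun y z => hab (y, z)
  obtain ⟨p, hp⟩ := hT.connected.exists_walk_length_eq_dist a b
  have hpath := p.isPath_of_length_eq_dist hp
  set d := T.dist a b with hd
  have hinj : Set.InjOn p.getVert (Finset.range (d + 1)) :=
    hpath.getVert_injOn.mono fun j hj => by
      have := Finset.mem_range.1 hj
      simp only [Set.mem_ofPred_eq]
      omega
  have hle : ∀ i, _root_.eccent T i ≤ d := fun i => eccent_le T fun j => hab i j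
  have hmin : ∀ j ∈ Finset.range (d + 1), min j (d - j) ≤ d - _root_.eccent T (p.getVert j) := by
    intro j hj
    have hj := Finset.mem_range.1 hj
    have h := hT.eccent_le_of_mem_support hab p hpath (p.getVert_mem_support j)
    have h1 : T.dist a (p.getVert j) ≤ j := (dist_le (p.take j)).trans (by simp)
    have h2 : T.dist (p.getVert j) b ≤ d - j := (dist_le (p.drop j)).trans (by simp [hp])
    have h3 := hT.connected.dist_triangle (u := a) (v := p.getVert j) (w := b)
    rw [dist_comm (u := p.getVert j) (v := a)] at h
    omega
  have hpaths : D * ∑ j ∈ Finset.range (d + 1), min j (d - j) ≤ ∑ v, (d - _root_.eccent T (f v)) := by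
    calc D * ∑ j ∈ Finset.range (d + 1), min j (d - j)
        ≤ D * ∑ j ∈ Finset.range (d + 1), (d - _root_.eccent T (p.getVert j)) := by
          gcongr with j hj; exact hmin j hj
      _ = D * ∑ i ∈ (Finset.range (d + 1)).image p.getVert, (d - _root_.eccent T i) := by
          rw [Finset.sum_image hinj]
      _ ≤ D * ∑ i, (d - _root_.eccent T i) := by
          gcongr; exact Finset.subset_univ _
      _ ≤ ∑ i, ∑ v with f v = i, (d - _root_.eccent T (f v)) := by
          rw [Finset.mul_sum]
          refine Finset.sum_le_sum fun i _ => ?_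
          rw [Finset.sum_congr rfl fun v hv => by rw [(Finset.mem_filter.1 hv).2],
            Finset.sum_const, smul_eq_mul]
          exact Nat.mul_le_mul_right _ (hf i)
      _ = ∑ v, (d - _root_.eccent T (f v)) := Finset.sum_fiberwise _ _ _
  have hsum : ∑ v, (d - _root_.eccent T (f v)) + ∑ v, _root_.eccent T (f v) = Fintype.card V * d := by
    rw [← Finset.sum_add_distrib, Finset.sum_congr rfl fun v _ => Nat.sub_add_cancel (hle (f v))]
    simp
  have hcard : (d + 1) * D ≤ Fintype.card V := by
    calc (d + 1) * D = ((Finset.range (d + 1)).image p.getVert).card * D := by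
          rw [Finset.card_image_of_injOn hinj, Finset.card_range]
      _ ≤ Fintype.card I * D := by gcongr; exact Finset.card_le_univ _
      _ = ∑ _i : I, D := by simp
      _ ≤ ∑ i, (Finset.univ.filter fun v => f v = i).card := Finset.sum_le_sum fun i _ => hf i
      _ = Fintype.card V := by
          rw [← Finset.card_univ]
          exact (Finset.card_eq_sum_card_fiberwise fun _ _ => Finset.mem_univ _).symm
  have hdK : d + 1 ≤ K := Nat.le_of_mul_le_mul_right (hcard.trans hK) hD
  have hsq := sq_le_four_mul_sum_min d
  generalize ∑ j ∈ Finset.range (d + 1), min j (d - j) = S at hpaths hsq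
  generalize ∑ v, (d - _root_.eccent T (f v)) = R at hpaths hsum
  generalize ∑ v, _root_.eccent T (f v) = E at hsum ⊢
  generalize Fintype.card V = n at *
  zify at hpaths hsum hcard hK hdK hsq hD
  have hE : (E : ℤ) ≤ n * d - D * S := by linarith
  have hS : (D : ℤ) * (d ^ 2 - 1) ≤ D * (4 * S) := by gcongr; linarith
  by_cases hc : (4 * d : ℤ) ≤ 3 * K - 2
  · have h1 : (n : ℤ) * (4 * d) ≤ n * (3 * K - 2) := by gcongr
    have h2 : (0 : ℤ) ≤ D * S := by positivity
    linarith
  · have h1 : (n : ℤ) * (4 * d - (3 * K - 2)) ≤ K * D * (4 * d - (3 * K - 2)) :=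
      mul_le_mul_of_nonneg_right hK (by linarith)
    have h2 : (K : ℤ) * (4 * d - (3 * K - 2)) ≤ d ^ 2 - 1 := by nlinarith
    have h3 : (D : ℤ) * (K * (4 * d - (3 * K - 2))) ≤ D * (d ^ 2 - 1) := by gcongr
    linarith

/-! ### Balls of radius two around an edge -/

lemma CycleFree.eq_of_adj {V : Type*} {G : SimpleGraph V} (h4 : CycleFree G 4) {a b x y : V}
    (hab : a ≠ b) (hax : G.Adj a x) (hbx : G.Adj b x) (hay : G.Adj a y) (hby : G.Adj b y) :
    x = y := by
  by_contra hxy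
  have hcycle : (Walk.cons hax (.cons hbx.symm (.cons hby (.cons hay.symm .nil)))).IsCycle := by
    rw [Walk.cons_isCycle_iff]
    simp [Walk.cons_isPath_iff, hab.symm, hxy, hbx.ne', hay.ne', hby.ne, hax.ne', hax.ne,
      hab]
  exact h4 _ hcycle rfl

lemma CycleFree.false_of_adj {V : Type*} {G : SimpleGraph V} (h5 : CycleFree G 5)
    {a b c d e : V} (hab : G.Adj a b) (hbc : G.Adj b c) (hcd : G.Adj c d) (hde : G.Adj d e)
    (hea : G.Adj e a) (hac : a ≠ c) (had : a ≠ d) (hbd : b ≠ d) (hbe : b ≠ e) (hce : c ≠ e) :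
    False := by
  have hcycle :
      (Walk.cons hab (.cons hbc (.cons hcd (.cons hde (.cons hea .nil))))).IsCycle := by
    rw [Walk.cons_isCycle_iff]
    simp [Walk.cons_isPath_iff, hab.ne, hab.ne', hbc.ne, hcd.ne, hde.ne, hea.ne, hac.symm, hac,
      had, had.symm, hbd, hbe, hce]
  exact h5 _ hcycle rfl

lemma dist_le_two_of_adj {V : Type*} {G : SimpleGraph V} {u x y : V} (hux : G.Adj u x) (hxy : G.Adj x y) :
    G.dist u y ≤ 2 :=
  dist_le (.cons hux (.cons hxy .nil))

section Ball

variable {V : Type*} [Fintype V] [DecidableEq V] (G : SimpleGraph V) [DecidableRel G.Adj]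

/-- The set `A` together with the neighbours, other than `u`, of its members. -/
def branch (u : V) (A : Finset V) : Finset V :=
  A ∪ A.biUnion fun x => (G.neighborFinset x).erase u

/-- The private neighbours of `u` along the edge `uv`: the neighbours of `u` that are neither equal
nor adjacent to `v`. -/
def privateNeighbors (u v : V) : Finset V :=
  (G.neighborFinset u).erase v \ G.neighborFinset v

variable {G}

lemma mem_branch {u x : V} {A : Finset V} :
    x ∈ branch G u A ↔ x ∈ A ∨ ∃ y ∈ A, x ≠ u ∧ G.Adj y x := by
  simp [branch]

lemma mem_privateNeighbors {u v x : V} :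
    x ∈ privateNeighbors G u v ↔ x ≠ v ∧ G.Adj u x ∧ ¬ G.Adj v x := by
  simp [privateNeighbors, and_assoc]

lemma even_sum_card_neighborFinset_inter (A : Finset V) :
    Even (∑ x ∈ A, (G.neighborFinset x ∩ A).card) := by
  have h := (G.induce (A : Set V)).sum_degrees_eq_twice_card_edges
  have hdeg : ∀ x : (A : Set V), (G.induce (A : Set V)).degree x =
      (G.neighborFinset x ∩ A).card := by
    intro x
    rw [← card_neighborFinset_eq_degree, ← Finset.card_map (Function.Embedding.subtype _)]
    congr 1
    ext y
    simp [and_comm]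
  rw [Finset.sum_congr rfl fun x _ => hdeg x] at h
  rw [← Finset.sum_coe_sort A]
  exact ⟨_, h.trans (two_mul _)⟩

lemma card_branch_ge (h4 : CycleFree G 4) {u : V} {A : Finset V} (hA : ∀ x ∈ A, G.Adj u x) :
    A.card * (G.minDegree - 1) + A.card % 2 ≤ (branch G u A).card := by
  have hbranch : branch G u A =
      A ∪ A.biUnion fun x => (G.neighborFinset x).erase u \ A := by
    ext y
    simp only [branch, Finset.mem_union, Finset.mem_biUnion, Finset.mem_sdiff]
    by_cases hy : y ∈ A <;> simp [hy]
  have hinter : ∀ x ∈ A, (G.neighborFinset x ∩ A).card ≤ 1 := by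
    intro x hx
    refine Finset.card_le_one.2 fun y hy z hz => ?_
    simp only [Finset.mem_inter, mem_neighborFinset] at hy hz
    exact h4.eq_of_adj (hA x hx).ne (hA y hy.2) hy.1 (hA z hz.2) hz.1
  have hdeg : ∀ x ∈ A, G.minDegree - 1 ≤
      ((G.neighborFinset x).erase u \ A).card + (G.neighborFinset x ∩ A).card := by
    intro x hx
    have hu : u ∉ A := fun hu => (hA u hu).ne rfl
    have h1 : (G.neighborFinset x).erase u ∩ A = G.neighborFinset x ∩ A := by
      ext y
      simp only [Finset.mem_inter, Finset.mem_erase]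
      refine ⟨fun h => ⟨h.1.2, h.2⟩, fun h => ⟨⟨?_, h.1⟩, h.2⟩⟩
      rintro rfl
      exact hu h.2
    rw [← h1, Finset.card_sdiff_add_card_inter, Finset.card_erase_of_mem
      ((mem_neighborFinset _ _ _).2 (hA x hx).symm), card_neighborFinset_eq_degree]
    exact Nat.sub_le_sub_right (G.minDegree_le_degree x) 1
  have hdisj : (A : Set V).PairwiseDisjoint fun x => (G.neighborFinset x).erase u \ A := by
    intro x hx y hy hxy
    refine Finset.disjoint_left.2 fun z hzx hzy => hxy ?_
    simp only [Finset.mem_sdiff, Finset.mem_erase, mem_neighborFinset] at hzx hzy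
    exact h4.eq_of_adj hzx.1.1.symm (hA x hx) hzx.1.2.symm (hA y hy) hzy.1.2.symm
  have hdisj' : Disjoint A (A.biUnion fun x => (G.neighborFinset x).erase u \ A) :=
    Finset.disjoint_left.2 fun z hz hz' => by
      obtain ⟨x, -, hx⟩ := Finset.mem_biUnion.1 hz'
      exact (Finset.mem_sdiff.1 hx).2 hz
  rw [hbranch, Finset.card_union_of_disjoint hdisj', Finset.card_biUnion hdisj]
  have hsum := Finset.sum_le_sum hdeg
  rw [Finset.sum_add_distrib, Finset.sum_const, smul_eq_mul] at hsum
  have hone := Finset.sum_le_sum hinter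
  rw [Finset.sum_const, smul_eq_mul, mul_one] at hone
  have heven := even_sum_card_neighborFinset_inter (G := G) A
  rw [Nat.even_iff] at heven
  omega

lemma degree_le_card_privateNeighbors {u v : V} :
    G.degree u ≤ (privateNeighbors G u v).card + 1 +
      (G.neighborFinset u ∩ G.neighborFinset v).card := by
  rw [← card_neighborFinset_eq_degree]
  have h1 := Finset.card_sdiff_add_card_inter ((G.neighborFinset u).erase v) (G.neighborFinset v)
  have h2 := Finset.card_le_card (Finset.inter_subset_inter_right (u := G.neighborFinset v)
    (Finset.erase_subset v (G.neighborFinset u)))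
  have h3 := Finset.pred_card_le_card_erase (s := G.neighborFinset u) (a := v)
  unfold privateNeighbors
  omega

lemma disjoint_branch_privateNeighbors (h4 : CycleFree G 4) (h5 : CycleFree G 5) {u v : V}
    (huv : G.Adj u v) :
    Disjoint (branch G u (privateNeighbors G u v)) (branch G v (privateNeighbors G v u)) := by
  refine Finset.disjoint_left.2 fun z hu hv => ?_
  simp only [mem_branch, mem_privateNeighbors] at hu hv
  rcases hu with ⟨h1, h2, h3⟩ | ⟨x, ⟨h1, h2, h3⟩, hzu, hxz⟩ <;>
  rcases hv with ⟨k1, k2, k3⟩ | ⟨y, ⟨k1, k2, k3⟩, k4, k5⟩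
  · exact h3 k2
  · exact k1 (h4.eq_of_adj k4 k5.symm k2 h2.symm huv.symm)
  · exact h1 (h4.eq_of_adj hzu hxz.symm h2 k2.symm huv)
  · refine h5.false_of_adj h2 hxz k5.symm k2.symm huv.symm hzu.symm k1.symm ?_ h1 k4
    rintro rfl
    exact h3 k2

/-- The number of vertices that are guaranteed within distance two of an edge of a
`(C₄, C₅)`-free graph of minimum degree `δ`. -/
def ballBound (δ : ℕ) : ℕ :=
  if Even δ then 2 * δ ^ 2 - 5 * δ + 5 else 2 * δ ^ 2 - 5 * δ + 7

lemma ballBound_pos (δ : ℕ) : 0 < ballBound δ := by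
  unfold ballBound
  split_ifs <;> omega

lemma mul_add_mod_two_mono {m a b : ℕ} (hm : 1 ≤ m) (hab : a ≤ b) :
    a * m + a % 2 ≤ b * m + b % 2 := by
  rcases hab.eq_or_lt with rfl | h
  · rfl
  · have := Nat.mul_le_mul_right m (Nat.succ_le_of_lt h)
    rw [Nat.succ_mul] at this
    omega

lemma ballBound_le_of_no_common {δ a b : ℕ} (hδ : 3 ≤ δ) (ha : δ ≤ a + 1) (hb : δ ≤ b + 1) :
    ballBound δ ≤ 2 + (a * (δ - 1) + a % 2) + (b * (δ - 1) + b % 2) := by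
  obtain ⟨m, rfl⟩ := Nat.exists_eq_add_of_le hδ
  have h1 := mul_add_mod_two_mono (m := 3 + m - 1) (by omega) (show m + 2 ≤ a by omega)
  have h2 := mul_add_mod_two_mono (m := 3 + m - 1) (by omega) (show m + 2 ≤ b by omega)
  have hsq : 2 * (3 + m) ^ 2 - 5 * (3 + m) = 2 * m ^ 2 + 7 * m + 3 :=
    Nat.sub_eq_of_eq_add (by ring)
  have hmul : (m + 2) * (3 + m - 1) = m ^ 2 + 4 * m + 4 := by
    rw [show 3 + m - 1 = m + 2 by omega]; ring
  rw [hmul] at h1 h2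
  unfold ballBound
  rw [hsq]
  simp only [Nat.even_iff]
  split_ifs <;> omega

lemma ballBound_le_of_common {δ a b : ℕ} (hδ : 3 ≤ δ) (ha : δ ≤ a + 2) (hb : δ ≤ b + 2) :
    ballBound δ ≤ (δ + 1) + (a * (δ - 1) + a % 2) + (b * (δ - 1) + b % 2) := by
  obtain ⟨m, rfl⟩ := Nat.exists_eq_add_of_le hδ
  have h1 := mul_add_mod_two_mono (m := 3 + m - 1) (by omega) (show m + 1 ≤ a by omega)
  have h2 := mul_add_mod_two_mono (m := 3 + m - 1) (by omega) (show m + 1 ≤ b by omega)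
  have hsq : 2 * (3 + m) ^ 2 - 5 * (3 + m) = 2 * m ^ 2 + 7 * m + 3 :=
    Nat.sub_eq_of_eq_add (by ring)
  have hmul : (m + 1) * (3 + m - 1) = m ^ 2 + 3 * m + 2 := by
    rw [show 3 + m - 1 = m + 2 by omega]; ring
  rw [hmul] at h1 h2
  unfold ballBound
  rw [hsq]
  simp only [Nat.even_iff]
  split_ifs <;> omega

lemma dist_le_two_of_mem_branch {u x : V} {A : Finset V} (hA : ∀ y ∈ A, G.Adj u y)
    (hx : x ∈ branch G u A) : G.dist u x ≤ 2 := by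
  rcases mem_branch.1 hx with h | ⟨y, hy, -, hyx⟩
  · exact (dist_eq_one_iff_adj.2 (hA x h)).le.trans one_le_two
  · exact dist_le_two_of_adj (hA y hy) hyx

/-- In a `(C₄, C₅)`-free graph, many vertices are within distance two of a given edge. -/
lemma ballBound_le_card_ball (h4 : CycleFree G 4) (h5 : CycleFree G 5) (hδ : 3 ≤ G.minDegree)
    {u v : V} (huv : G.Adj u v) :
    ballBound G.minDegree ≤
      (Finset.univ.filter fun x => min (G.dist u x) (G.dist v x) ≤ 2).card := by
  set A := privateNeighbors G u v with hA
  set B := privateNeighbors G v u with hB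
  have hAu : ∀ x ∈ A, G.Adj u x := fun x hx => (mem_privateNeighbors.1 hx).2.1
  have hBv : ∀ x ∈ B, G.Adj v x := fun x hx => (mem_privateNeighbors.1 hx).2.1
  have hAcard := card_branch_ge h4 hAu
  have hBcard := card_branch_ge h4 hBv
  have hdu := (G.minDegree_le_degree u).trans (degree_le_card_privateNeighbors (v := v))
  have hdv := (G.minDegree_le_degree v).trans (degree_le_card_privateNeighbors (v := u))
  have hdisj := disjoint_branch_privateNeighbors h4 h5 huv
  rw [← hA, ← hB] at hdisj
  rw [← hA] at hdu
  rw [← hB] at hdv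
  -- a core that avoids both branches contributes to the ball in addition to them
  have hcore : ∀ C : Finset V, Disjoint C (branch G u A) → Disjoint C (branch G v B) →
      (∀ x ∈ C, min (G.dist u x) (G.dist v x) ≤ 2) →
      C.card + (branch G u A).card + (branch G v B).card ≤
        (Finset.univ.filter fun x => min (G.dist u x) (G.dist v x) ≤ 2).card := by
    intro C hCA hCB hC
    rw [← Finset.card_union_of_disjoint hCA, ← Finset.card_union_of_disjoint
      (Finset.disjoint_union_left.2 ⟨hCB, hdisj⟩)]
    refine Finset.card_le_card fun x hx => Finset.mem_filter.2 ⟨Finset.mem_univ _, ?_⟩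
    simp only [Finset.mem_union] at hx
    rcases hx with (hx | hx) | hx
    · exact hC x hx
    · exact (min_le_left _ _).trans (dist_le_two_of_mem_branch hAu hx)
    · exact (min_le_right _ _).trans (dist_le_two_of_mem_branch hBv hx)
  have hends : ∀ {a b : V}, G.Adj a b →
      Disjoint ({a, b} : Finset V) (branch G a (privateNeighbors G a b)) := by
    intro a b hab
    refine Finset.disjoint_left.2 fun x hx hx' => ?_
    simp only [mem_branch, mem_privateNeighbors] at hx'
    rcases Finset.mem_insert.1 hx with rfl | hx
    · rcases hx' with h | ⟨y, -, h, -⟩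
      · exact h.2.1.ne rfl
      · exact h rfl
    · rw [Finset.mem_singleton.1 hx] at hx'
      rcases hx' with h | ⟨y, h, -, h'⟩
      · exact h.1 rfl
      · exact h.2.2 h'.symm
  rcases (G.neighborFinset u ∩ G.neighborFinset v).eq_empty_or_nonempty with hC | ⟨w, hw⟩
  · rw [hC, Finset.card_empty] at hdu
    rw [Finset.inter_comm, hC, Finset.card_empty] at hdv
    have hBends := hends huv.symm
    rw [Finset.pair_comm] at hBends
    have h := hcore {u, v} (hends huv) hBends (by
      intro x hx
      rcases Finset.mem_insert.1 hx with rfl | hx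
      · simp
      · rw [Finset.mem_singleton.1 hx]
        simp)
    rw [Finset.card_pair huv.ne] at h
    have := ballBound_le_of_no_common hδ hdu hdv
    omega
  · have hw' := hw
    simp only [Finset.mem_inter, mem_neighborFinset] at hw'
    obtain ⟨huw, hvw⟩ := hw'
    have hone : (G.neighborFinset u ∩ G.neighborFinset v).card ≤ 1 := by
      refine Finset.card_le_one.2 fun y hy z hz => ?_
      simp only [Finset.mem_inter, mem_neighborFinset] at hy hz
      exact h4.eq_of_adj huv.ne hy.1 hy.2 hz.1 hz.2
    have hcoreDisj : ∀ {a b : V}, G.Adj a b → G.Adj a w → G.Adj b w →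
        Disjoint (insert w (G.neighborFinset w)) (branch G a (privateNeighbors G a b)) := by
      intro a b hab haw hbw
      have hnot : ∀ y ∈ privateNeighbors G a b, ¬ G.Adj w y := by
        intro y hy hwy
        rw [mem_privateNeighbors] at hy
        exact hy.1 (h4.eq_of_adj haw.ne hy.2.1 hwy hab hbw.symm)
      refine Finset.disjoint_left.2 fun x hx hx' => ?_
      rw [mem_branch] at hx'
      rcases Finset.mem_insert.1 hx with rfl | hx
      · rcases hx' with h | ⟨y, hy, -, h⟩
        · exact (mem_privateNeighbors.1 h).2.2 hbw
        · exact hnot y hy h.symm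
      · rw [mem_neighborFinset] at hx
        rcases hx' with h | ⟨y, hy, hxa, hyx⟩
        · exact hnot x h hx
        · have hy' := mem_privateNeighbors.1 hy
          have : y = w := h4.eq_of_adj hxa.symm hy'.2.1 hyx.symm haw hx.symm
          exact hy'.2.2 (this ▸ hbw)
    have h := hcore (insert w (G.neighborFinset w)) (hcoreDisj huv huw hvw)
      (hcoreDisj huv.symm hvw huw) (by
        intro x hx
        refine (min_le_left _ _).trans ?_
        rcases Finset.mem_insert.1 hx with rfl | hx
        · exact (dist_eq_one_iff_adj.2 huw).le.trans one_le_two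
        · exact dist_le_two_of_adj huw ((mem_neighborFinset _ _ _).1 hx))
    rw [Finset.card_insert_of_notMem (by simp), card_neighborFinset_eq_degree] at h
    have hdw := G.minDegree_le_degree w
    rw [Finset.inter_comm] at hdv
    have := ballBound_le_of_common (a := A.card) (b := B.card) hδ (by omega) (by omega)
    omega

end Ball

/-! ### Well separated edges -/

section Packing

variable {V : Type*} (G : SimpleGraph V)

/-- The distance from the pair `e` of vertices to the vertex `x`. -/
noncomputable def pairDist (e : V × V) (x : V) : ℕ :=
  min (G.dist e.1 x) (G.dist e.2 x)

/-- The graph on pairs of vertices in which distinct pairs at distance at most five are linked. -/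
def linkGraph : SimpleGraph (V × V) where
  Adj e f := e ≠ f ∧ (pairDist G e f.1 ≤ 5 ∨ pairDist G e f.2 ≤ 5)
  symm := ⟨by
    rintro e f ⟨hne, h⟩
    refine ⟨hne.symm, ?_⟩
    simp only [pairDist, G.dist_comm (u := e.1), G.dist_comm (u := e.2)] at h ⊢
    omega⟩
  loopless := ⟨fun _ h => h.1 rfl⟩

/-- A set of edges that are pairwise at distance at least five and linked together by steps of
distance five. -/
structure IsLinkedPacking (M : Set (V × V)) : Prop where
  adj : ∀ e ∈ M, G.Adj e.1 e.2
  separated : ∀ e ∈ M, ∀ f ∈ M, e ≠ f → 5 ≤ pairDist G e f.1 ∧ 5 ≤ pairDist G e f.2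
  connected : ((linkGraph G).induce M).Connected

variable {G}

lemma pairDist_le_of_adj (hG : G.Connected) (e : V × V) {x y : V} (hxy : G.Adj x y) :
    pairDist G e y ≤ pairDist G e x + 1 := by
  have h1 := hG.dist_triangle (u := e.1) (v := x) (w := y)
  have h2 := hG.dist_triangle (u := e.2) (v := x) (w := y)
  rw [dist_eq_one_iff_adj.2 hxy] at h1 h2
  unfold pairDist
  omega

lemma IsLinkedPacking.singleton {u v : V} (huv : G.Adj u v) : IsLinkedPacking G {(u, v)} where
  adj := by simpa using huv
  separated := by
    rintro e rfl f rfl h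
    exact absurd rfl h
  connected := by
    have : Subsingleton ({(u, v)} : Set (V × V)) := Set.subsingleton_singleton.coe_sort
    have : Nonempty ({(u, v)} : Set (V × V)) := ⟨⟨_, rfl⟩⟩
    exact ⟨.of_subsingleton⟩

lemma IsLinkedPacking.insert {M : Set (V × V)} (hM : IsLinkedPacking G M) {x y : V}
    (hxy : G.Adj x y) (hx : ∀ e ∈ M, 5 ≤ pairDist G e x) (hy : ∀ e ∈ M, 5 ≤ pairDist G e y)
    {f : V × V} (hf : f ∈ M) (hfx : pairDist G f x ≤ 5) :
    IsLinkedPacking G (insert (x, y) M) where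
  adj := by
    rintro e (rfl | he)
    · exact hxy
    · exact hM.adj e he
  separated := by
    rintro e (rfl | he) g (rfl | hg) hne
    · exact absurd rfl hne
    · have h1 := hx g hg
      have h2 := hy g hg
      simp only [pairDist, G.dist_comm (u := x), G.dist_comm (u := y)] at h1 h2 ⊢
      omega
    · exact ⟨hx e he, hy e he⟩
    · exact hM.separated e he g hg hne
  connected := by
    have hne : f ≠ (x, y) := by
      rintro rfl
      have := hx _ hf
      simp [pairDist] at this
    have := connected_induce_union hM.connected.preconnected
      (IsLinkedPacking.singleton hxy).connected.preconnected hf rfl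
      (show (linkGraph G).Adj f (x, y) from ⟨hne, .inl hfx⟩)
    rwa [Set.union_singleton] at this

/-- There is a linked packing that has every vertex within distance five of it. -/
lemma exists_isLinkedPacking [Finite V] (hG : G.Connected) {u v : V} (huv : G.Adj u v) :
    ∃ M, IsLinkedPacking G M ∧ ∀ x, ∃ e ∈ M, pairDist G e x ≤ 5 := by
  obtain ⟨M, hM, hmax⟩ := (Set.toFinite {M | IsLinkedPacking G M}).exists_maximal
    ⟨_, IsLinkedPacking.singleton huv⟩
  replace hM : IsLinkedPacking G M := hM
  refine ⟨M, hM, ?_⟩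
  obtain ⟨⟨f, hf⟩⟩ := hM.connected.nonempty
  intro z
  obtain ⟨p⟩ := hG.preconnected f.1 z
  suffices H : ∀ {a b : V} (p : G.Walk a b), (∃ e ∈ M, pairDist G e a ≤ 5) →
      ∃ e ∈ M, pairDist G e b ≤ 5 from H p ⟨f, hf, by simp [pairDist]⟩
  intro a b p
  induction p with
  | nil => exact id
  | @cons a c b hac p ih =>
    rintro ⟨e, he, hea⟩
    refine ih ?_
    by_contra! hc
    have ha : ∀ g ∈ M, 5 ≤ pairDist G g a := fun g hg => by
      have := hc g hg
      have := pairDist_le_of_adj hG g hac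
      omega
    have hle : insert (a, c) M ⊆ M :=
      hmax (hM.insert hac ha (fun g hg => (hc g hg).le) he hea) (Set.subset_insert _ _)
    have := hc _ (hle (Set.mem_insert _ _))
    simp [pairDist] at this

lemma dist_le_of_walk_linkGraph (hG : G.Connected) {M : Set (V × V)}
    (hM : ∀ e ∈ M, G.Adj e.1 e.2) {e f : M} (p : ((linkGraph G).induce M).Walk e f)
    {a b : V} (ha : a = e.1.1 ∨ a = e.1.2) (hb : b = f.1.1 ∨ b = f.1.2) :
    G.dist a b ≤ 6 * p.length + 1 := by
  have hends : ∀ e : M, ∀ {a b : V}, (a = e.1.1 ∨ a = e.1.2) → (b = e.1.1 ∨ b = e.1.2) →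
      G.dist a b ≤ 1 := by
    intro e a b ha hb
    have h1 := dist_eq_one_iff_adj.2 (hM e e.2)
    have h2 := dist_eq_one_iff_adj.2 (hM e e.2).symm
    rcases ha with rfl | rfl <;> rcases hb with rfl | rfl <;> simp [h1, h2]
  induction p generalizing a with
  | nil => simpa using hends _ ha hb
  | @cons e g f heg p ih =>
    obtain ⟨x, y, hx, hy, hxy⟩ : ∃ x y, (x = e.1.1 ∨ x = e.1.2) ∧ (y = g.1.1 ∨ y = g.1.2) ∧
        G.dist x y ≤ 5 := by
      have h : pairDist G e.1 g.1.1 ≤ 5 ∨ pairDist G e.1 g.1.2 ≤ 5 := heg.2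
      simp only [pairDist, min_le_iff] at h
      rcases h with (h | h) | (h | h)
      exacts [⟨_, _, .inl rfl, .inl rfl, h⟩, ⟨_, _, .inr rfl, .inl rfl, h⟩,
        ⟨_, _, .inl rfl, .inr rfl, h⟩, ⟨_, _, .inr rfl, .inr rfl, h⟩]
    have h1 := hends e ha hx
    have h2 := ih hy hb
    have h3 := hG.dist_triangle (u := a) (v := x) (w := b)
    have h4 := hG.dist_triangle (u := x) (v := y) (w := b)
    rw [Walk.length_cons]
    omega

lemma exists_end_dist_eq_pairDist (e : V × V) (x : V) :
    ∃ a, (a = e.1 ∨ a = e.2) ∧ G.dist a x = pairDist G e x := by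
  rcases min_choice (G.dist e.1 x) (G.dist e.2 x) with h | h
  exacts [⟨_, .inl rfl, h.symm⟩, ⟨_, .inr rfl, h.symm⟩]

end Packing

/-- The eccentricity sum of a `(C₄, C₅)`-free graph of minimum degree at least three. -/
theorem four_mul_sum_eccent_le {V : Type*} [Fintype V] (G : SimpleGraph V) [DecidableRel G.Adj]
    (hG : G.Connected) (h4 : CycleFree G 4) (h5 : CycleFree G 5) (h3 : 3 ≤ G.minDegree) {K : ℕ}
    (hK : Fintype.card V ≤ K * ballBound G.minDegree) :
    4 * ((∑ v, _root_.eccent G v : ℕ) : ℤ) ≤ Fintype.card V * (18 * K + 32) := by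
  classical
  obtain ⟨u⟩ := hG.nonempty
  obtain ⟨v, huv⟩ : ∃ v, G.Adj u v := by
    rw [← degree_pos_iff_exists_adj]
    exact (by omega : 0 < G.minDegree).trans_le (G.minDegree_le_degree u)
  obtain ⟨M, hM, hcover⟩ := exists_isLinkedPacking hG huv
  have := hM.connected.nonempty
  obtain ⟨T, hTle, hT⟩ := hM.connected.exists_isTree_le
  choose f hf using fun x => Finite.exists_min fun e : M => pairDist G e x
  have hf5 : ∀ x, pairDist G (f x) x ≤ 5 := fun x => by
    obtain ⟨e, he, hex⟩ := hcover x
    exact (hf x ⟨e, he⟩).trans hex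
  have hfib : ∀ e : M, ballBound G.minDegree ≤ (Finset.univ.filter fun x => f x = e).card := by
    intro e
    refine (ballBound_le_card_ball h4 h5 h3 (hM.adj e e.2)).trans (Finset.card_le_card ?_)
    intro x hx
    have hex : pairDist G e x ≤ 2 := (Finset.mem_filter.1 hx).2
    refine Finset.mem_filter.2 ⟨Finset.mem_univ _, ?_⟩
    by_contra hne
    obtain ⟨h1, h2⟩ := hM.separated e e.2 (f x) (f x).2 fun h => hne (Subtype.ext h.symm)
    obtain ⟨a, ha, hax⟩ := exists_end_dist_eq_pairDist (G := G) e x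
    obtain ⟨b, hb, hbx⟩ := exists_end_dist_eq_pairDist (G := G) (f x) x
    have hab : 5 ≤ G.dist a b := by
      rcases ha with rfl | rfl <;> rcases hb with rfl | rfl <;>
        simp only [pairDist, le_min_iff] at h1 h2 <;> tauto
    have h3 := hG.dist_triangle (u := a) (v := x) (w := b)
    have h4 := hf x e
    rw [G.dist_comm (u := x) (v := b)] at h3
    omega
  have hecc : ∀ x, _root_.eccent G x ≤ 6 * _root_.eccent T (f x) + 11 := by
    refine fun x => eccent_le G fun y => ?_
    obtain ⟨p, hp⟩ := hT.connected.exists_walk_length_eq_dist (f x) (f y)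
    obtain ⟨a, ha, hax⟩ := exists_end_dist_eq_pairDist (G := G) (f x) x
    obtain ⟨b, hb, hby⟩ := exists_end_dist_eq_pairDist (G := G) (f y) y
    have h1 := dist_le_of_walk_linkGraph hG hM.adj (p.mapLe hTle) ha hb
    have h2 := hG.dist_triangle (u := x) (v := a) (w := y)
    have h3 := hG.dist_triangle (u := a) (v := b) (w := y)
    have h4 := dist_le_eccent T (f x) (f y)
    have h5 := hf5 x
    have h6 := hf5 y
    rw [G.dist_comm (u := x) (v := a)] at h2
    rw [Walk.length_map] at h1
    omega
  have hsum := Finset.sum_le_sum fun x (_ : x ∈ Finset.univ) => hecc x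
  rw [Finset.sum_add_distrib, ← Finset.mul_sum, Finset.sum_const, Finset.card_univ,
    smul_eq_mul] at hsum
  have htree := hT.four_mul_sum_eccent_le f hfib (ballBound_pos _) hK
  zify at hsum htree ⊢
  linarith

theorem stmt_9 {V : Type*} [Fintype V] (G : SimpleGraph V) [DecidableRel G.Adj]
    (hG : G.Connected) (h4 : CycleFree G 4) (h5 : CycleFree G 5) (n δ : ℕ)
    (hn : n = Fintype.card V) (hδ : δ = G.minDegree) (h3 : 3 ≤ δ) :
    avec G ≤ 9 / 2 *
      (⌈(n : ℝ) / ((if Even δ then 2 * δ ^ 2 - 5 * δ + 5 else 2 * δ ^ 2 - 5 * δ + 7 : ℕ) : ℝ)⌉ : ℝ)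
      + 8 := by
  subst hn hδ
  have hnonempty := hG.nonempty
  change avec G ≤ 9 / 2 * (⌈(Fintype.card V : ℝ) / (ballBound G.minDegree : ℝ)⌉ : ℝ) + 8
  have hD : (0 : ℝ) < ballBound G.minDegree := by exact_mod_cast ballBound_pos _
  rw [← natCast_ceil_eq_intCast_ceil (by positivity)]
  set K := ⌈(Fintype.card V : ℝ) / (ballBound G.minDegree : ℝ)⌉₊
  have hK : Fintype.card V ≤ K * ballBound G.minDegree := by
    have h := Nat.le_ceil ((Fintype.card V : ℝ) / (ballBound G.minDegree : ℝ))
    rw [div_le_iff₀ hD] at h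
    exact_mod_cast h
  have hmain := four_mul_sum_eccent_le G hG h4 h5 h3 hK
  have hcard : (0 : ℝ) < Fintype.card V := by exact_mod_cast Fintype.card_pos
  have hreal : 4 * ∑ v, (_root_.eccent G v : ℝ) ≤ Fintype.card V * (18 * K + 32) := by
    exact_mod_cast hmain
  rw [avec, finsum_eq_sum_of_fintype, Nat.card_eq_fintype_card, div_le_iff₀ hcard]
  linarith
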